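/- arXiv:1609.05580 — 2 statements merged into one kernel-verified Lean document; each statement's English description precedes it below -/
import Mathlib

section
/- Let d ≥ 1 and ξ ∈ ℤ^d be fixed. Then w_{(n,ξ)} ~ d^{2n + d/2 + ‖ξ‖₁} · (4πn)^{(1−d)/2} as n → ∞; that is, lim_{n→∞} w_{(n,ξ)} / ( d^{2n + d/2 + ‖ξ‖₁} (4πn)^{(1−d)/2} ) = 1. -/
/-- The number `w_{(n,ξ)}` of `n`-th order words offset by `ξ` over a `d`-letter alphabet. -/
def wcount (d n : ℕ) (ξ : Fin d → ℤ) : ℕ :=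
  ∑ ν ∈ Finset.Nat.antidiagonalTuple d n,
    Nat.multinomial Finset.univ (fun j => ν j + (ξ j).toNat) *
      Nat.multinomial Finset.univ (fun j => ν j + (-ξ j).toNat)

open MeasureTheory Filter Topology Finset
open scoped ComplexConjugate

/-- The pairs of compositions of `n + |ξ⁺|` and `n + |ξ⁻|` that differ by `ξ`, counted with their
multinomial weights. -/
theorem wcount_eq_sum_piAntidiag (d n : ℕ) (ξ : Fin d → ℤ) :
    wcount d n ξ =
      ∑ μ ∈ piAntidiag univ (n + ∑ j, (ξ j).toNat),
        ∑ ν ∈ piAntidiag univ (n + ∑ j, (-ξ j).toNat),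
          if ∀ j, (μ j : ℤ) - ν j = ξ j then
            Nat.multinomial univ μ * Nat.multinomial univ ν else 0 := by
  rw [← sum_product', ← sum_filter, wcount]
  refine sum_nbij' (fun ν => (fun j => ν j + (ξ j).toNat, fun j => ν j + (-ξ j).toNat))
    (fun p j => p.1 j - (ξ j).toNat) ?_ ?_ ?_ ?_ ?_
  · intro ν hν
    rw [Nat.mem_antidiagonalTuple] at hν
    simp only [mem_filter, mem_product, mem_piAntidiag, sum_add_distrib, hν, mem_univ,
      implies_true, and_self, true_and]
    intro j
    push_cast
    omega
  · rintro ⟨μ, ν⟩ h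
    simp only [mem_filter, mem_product, mem_piAntidiag, mem_univ, implies_true, and_true] at h
    obtain ⟨⟨hμ, -⟩, h⟩ := h
    rw [Nat.mem_antidiagonalTuple]
    have key : ∑ j, (μ j - (ξ j).toNat) + ∑ j, (ξ j).toNat = ∑ j, μ j := by
      rw [← sum_add_distrib]
      refine sum_congr rfl fun j _ => ?_
      have := h j
      omega
    have hμ' : ∑ j, μ j = n + ∑ j, (ξ j).toNat := hμ
    simp only
    omega
  · intro ν _
    ext j
    simp
  · rintro ⟨μ, ν⟩ h
    simp only [mem_filter] at h
    refine Prod.ext ?_ ?_ <;> ext j <;> have := h.2 j <;> simp only <;> omega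
  · intro ν _
    rfl

/-- The sum of the unit complex numbers with arguments `x j`. -/
noncomputable def trigSum {ι : Type*} [Fintype ι] (x : ι → ℝ) : ℂ :=
  ∑ j, Complex.exp (x j * Complex.I)

theorem continuous_trigSum {ι : Type*} [Fintype ι] : Continuous (trigSum (ι := ι)) := by
  unfold trigSum
  fun_prop

theorem norm_trigSum_le {ι : Type*} [Fintype ι] (x : ι → ℝ) :
    ‖trigSum x‖ ≤ Fintype.card ι := by
  refine (norm_sum_le _ _).trans ?_
  simp [Complex.norm_exp_ofReal_mul_I]

theorem normSq_trigSum {ι : Type*} [Fintype ι] (x : ι → ℝ) :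
    Complex.normSq (trigSum x) = ∑ j, ∑ k, Real.cos (x j - x k) := by
  simp only [trigSum, Complex.normSq_apply, Complex.re_sum, Complex.im_sum,
    Complex.exp_ofReal_mul_I_re, Complex.exp_ofReal_mul_I_im, sum_mul_sum, ← sum_add_distrib,
    Real.cos_sub]

theorem trigSum_pow {ι : Type*} [Fintype ι] [DecidableEq ι] (x : ι → ℝ) (N : ℕ) :
    trigSum x ^ N = ∑ μ ∈ piAntidiag univ N,
      (Nat.multinomial univ μ : ℂ) * ∏ j, Complex.exp (μ j * x j * Complex.I) := by
  rw [trigSum, sum_pow_eq_sum_piAntidiag]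
  refine sum_congr rfl fun μ _ => ?_
  congr 1
  refine prod_congr rfl fun j _ => ?_
  rw [← Complex.exp_nat_mul, mul_assoc]

theorem conj_trigSum_pow {ι : Type*} [Fintype ι] [DecidableEq ι] (x : ι → ℝ) (N : ℕ) :
    conj (trigSum x) ^ N = ∑ μ ∈ piAntidiag univ N,
      (Nat.multinomial univ μ : ℂ) * ∏ j, Complex.exp (-(μ j * x j * Complex.I)) := by
  rw [← map_pow, trigSum_pow, map_sum]
  refine sum_congr rfl fun μ _ => ?_
  simp [map_prod, ← Complex.exp_conj]

theorem setIntegral_exp_int_mul_I (k : ℤ) :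
    ∫ t in Set.Ioc (-Real.pi) Real.pi, Complex.exp (k * (t : ℂ) * Complex.I) =
      if k = 0 then 2 * (Real.pi : ℂ) else 0 := by
  rw [← intervalIntegral.integral_of_le (by linarith [Real.pi_pos])]
  split_ifs with hk
  · subst hk
    simp
    ring
  · have hc : (k : ℂ) * Complex.I ≠ 0 := by simp [hk]
    have h := integral_exp_mul_complex (a := -Real.pi) (b := Real.pi) hc
    simp only [mul_right_comm _ Complex.I] at h
    rw [h, div_eq_zero_iff, sub_eq_zero]
    left
    rw [Complex.exp_eq_exp_iff_exists_int]
    exact ⟨k, by push_cast; ring⟩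

/-- The cube `(-π, π]^m`. -/
def piCube (m : ℕ) : Set (Fin m → ℝ) := Set.univ.pi fun _ => Set.Ioc (-Real.pi) Real.pi

theorem measurableSet_piCube (m : ℕ) : MeasurableSet (piCube m) :=
  MeasurableSet.univ_pi fun _ => measurableSet_Ioc

theorem setIntegral_piCube_prod_exp {m : ℕ} (k : Fin m → ℤ) :
    ∫ θ in piCube m, ∏ j, Complex.exp (k j * (θ j : ℂ) * Complex.I) =
      if ∀ j, k j = 0 then (2 * (Real.pi : ℂ)) ^ m else 0 := by
  rw [piCube, volume_pi, Measure.restrict_pi_pi,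
    integral_fintype_prod_eq_prod (fun j (t : ℝ) => Complex.exp (k j * (t : ℂ) * Complex.I))]
  simp only [setIntegral_exp_int_mul_I]
  split_ifs with h
  · simp [h]
  · push Not at h
    obtain ⟨j, hj⟩ := h
    exact prod_eq_zero (mem_univ j) (by simp [hj])

/-- The function whose mean over the torus is the number of words. -/
noncomputable def wordKernel {m : ℕ} (n : ℕ) (ξ : Fin (m + 1) → ℤ) (x : Fin (m + 1) → ℝ) : ℂ :=
  trigSum x ^ (n + ∑ j, (ξ j).toNat) * conj (trigSum x) ^ (n + ∑ j, (-ξ j).toNat) *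
    ∏ j, Complex.exp (-(ξ j * x j * Complex.I))

theorem continuous_wordKernel {m : ℕ} (n : ℕ) (ξ : Fin (m + 1) → ℤ) :
    Continuous (wordKernel n ξ) := by
  have := continuous_trigSum (ι := Fin (m + 1))
  unfold wordKernel
  fun_prop

theorem wordKernel_cons_zero {m : ℕ} (n : ℕ) (ξ : Fin (m + 1) → ℤ) (θ : Fin m → ℝ) :
    wordKernel n ξ (Fin.cons 0 θ) =
      ∑ μ ∈ piAntidiag univ (n + ∑ j, (ξ j).toNat),
        ∑ ν ∈ piAntidiag univ (n + ∑ j, (-ξ j).toNat),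
          (Nat.multinomial univ μ * Nat.multinomial univ ν : ℂ) *
            ∏ j : Fin m, Complex.exp
              (((μ j.succ - ν j.succ - ξ j.succ : ℤ) : ℂ) * (θ j : ℂ) * Complex.I) := by
  rw [wordKernel, trigSum_pow, conj_trigSum_pow, sum_mul_sum, sum_mul]
  refine sum_congr rfl fun μ _ => ?_
  rw [sum_mul]
  refine sum_congr rfl fun ν _ => ?_
  simp only [Fin.prod_univ_succ, Fin.cons_zero, Fin.cons_succ, Complex.ofReal_zero, mul_zero,
    zero_mul, neg_zero, Complex.exp_zero, one_mul]
  rw [mul_mul_mul_comm, mul_assoc, ← prod_mul_distrib, ← prod_mul_distrib]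
  congr 1
  refine prod_congr rfl fun j _ => ?_
  rw [← Complex.exp_add, ← Complex.exp_add]
  congr 1
  push_cast
  ring

theorem setIntegral_piCube_wordKernel {m : ℕ} (n : ℕ) (ξ : Fin (m + 1) → ℤ) :
    ∫ θ in piCube m, wordKernel n ξ (Fin.cons 0 θ) =
      (2 * (Real.pi : ℂ)) ^ m * wcount (m + 1) n ξ := by
  have hint : ∀ (c : ℂ) (k : Fin m → ℤ), Integrable (fun θ : Fin m → ℝ =>
      c * ∏ j, Complex.exp (k j * (θ j : ℂ) * Complex.I)) (volume.restrict (piCube m)) := by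
    intro c k
    have hK : IsCompact (Set.univ.pi fun _ : Fin m => Set.Icc (-Real.pi) Real.pi) :=
      isCompact_univ_pi fun _ => isCompact_Icc
    have hcont : Continuous (fun θ : Fin m → ℝ =>
      c * ∏ j, Complex.exp (k j * (θ j : ℂ) * Complex.I)) := by fun_prop
    exact (hcont.continuousOn.integrableOn_compact hK).mono_set
      (Set.pi_mono fun _ _ => Set.Ioc_subset_Icc_self)
  simp only [wordKernel_cons_zero]
  rw [integral_finsetSum _ fun μ _ => integrable_finsetSum _ fun ν _ => hint _ _,
    wcount_eq_sum_piAntidiag]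
  simp only [Nat.cast_sum, Nat.cast_ite, Nat.cast_mul, Nat.cast_zero]
  rw [mul_sum]
  refine sum_congr rfl fun μ hμ => ?_
  rw [integral_finsetSum _ fun ν _ => hint _ _, mul_sum]
  refine sum_congr rfl fun ν hν => ?_
  rw [integral_const_mul, setIntegral_piCube_prod_exp]
  have hiff : (∀ j : Fin m, (μ j.succ - ν j.succ - ξ j.succ : ℤ) = 0) ↔
      ∀ j, (μ j : ℤ) - ν j = ξ j := by
    refine ⟨fun h => ?_, fun h j => sub_eq_zero.2 (h j.succ)⟩
    have hs : ∑ j, ((μ j : ℤ) - ν j - ξ j) = 0 := by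
      simp only [mem_piAntidiag] at hμ hν
      have hξ : ∑ j, ξ j = ∑ j, ((ξ j).toNat : ℤ) - ∑ j, ((-ξ j).toNat : ℤ) := by
        rw [← sum_sub_distrib]
        exact sum_congr rfl fun j _ => by omega
      have h1 : ∑ j, (μ j : ℤ) = n + ∑ j, ((ξ j).toNat : ℤ) := by exact_mod_cast hμ.1
      have h2 : ∑ j, (ν j : ℤ) = n + ∑ j, ((-ξ j).toNat : ℤ) := by exact_mod_cast hν.1
      rw [sum_sub_distrib, sum_sub_distrib, h1, h2, hξ]
      ring
    rw [Fin.sum_univ_succ, sum_eq_zero fun j _ => h j, add_zero] at hs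
    intro j
    refine Fin.cases ?_ (fun j => ?_) j
    · exact sub_eq_zero.1 hs
    · exact sub_eq_zero.1 (h j)
  simp only [hiff, mul_ite, mul_zero]
  split_ifs
  · ring
  · rfl

theorem normSq_trigSum_cons_zero_le {m : ℕ} {θ : Fin m → ℝ} (hθ : θ ∈ piCube m) :
    Complex.normSq (trigSum (Fin.cons 0 θ : Fin (m + 1) → ℝ)) ≤
      ((m : ℝ) + 1) ^ 2 - 4 / Real.pi ^ 2 * ∑ j, θ j ^ 2 := by
  have hcos : ∑ j, Real.cos (θ j) ≤ m - 2 / Real.pi ^ 2 * ∑ j, θ j ^ 2 := by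
    calc ∑ j, Real.cos (θ j) ≤ ∑ j, (1 - 2 / Real.pi ^ 2 * θ j ^ 2) := by
          refine sum_le_sum fun j _ => Real.cos_le_one_sub_mul_cos_sq ?_
          exact abs_le.2 (Set.Ioc_subset_Icc_self (hθ j (Set.mem_univ j)))
      _ = m - 2 / Real.pi ^ 2 * ∑ j, θ j ^ 2 := by simp [sum_sub_distrib, mul_sum]
  have hsq : ∑ j, ∑ k, Real.cos (θ j - θ k) ≤ (m : ℝ) ^ 2 := by
    calc ∑ j, ∑ k, Real.cos (θ j - θ k) ≤ ∑ _j : Fin m, ∑ _k : Fin m, (1 : ℝ) :=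
          sum_le_sum fun j _ => sum_le_sum fun k _ => Real.cos_le_one _
      _ = (m : ℝ) ^ 2 := by simp [sq]
  rw [normSq_trigSum]
  simp only [Fin.sum_univ_succ, Fin.cons_zero, Fin.cons_succ, sub_zero, zero_sub, Real.cos_neg,
    Real.cos_zero, sum_add_distrib]
  have : 4 / Real.pi ^ 2 * ∑ j, θ j ^ 2 = 2 * (2 / Real.pi ^ 2 * ∑ j, θ j ^ 2) := by ring
  nlinarith

theorem tendsto_inv_sqrt_natCast : Tendsto (fun n : ℕ => (√(n : ℝ))⁻¹) atTop (𝓝 0) :=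
  tendsto_inv_atTop_zero.comp (Real.tendsto_sqrt_atTop.comp tendsto_natCast_atTop_atTop)

theorem tendsto_mul_one_sub_cos_div_sqrt (y : ℝ) :
    Tendsto (fun n : ℕ => (n : ℝ) * (1 - Real.cos ((√(n : ℝ))⁻¹ * y))) atTop (𝓝 (y ^ 2 / 2)) := by
  have harg : Tendsto (fun n : ℕ => (√(n : ℝ))⁻¹ * y / 2) atTop (𝓝 0) := by
    simpa using (tendsto_inv_sqrt_natCast.mul_const y).div_const 2
  have hsinc : Tendsto (fun n : ℕ => y ^ 2 / 2 * Real.sinc ((√(n : ℝ))⁻¹ * y / 2) ^ 2) atTop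
      (𝓝 (y ^ 2 / 2)) := by
    have := ((Real.continuous_sinc.tendsto 0).comp harg).pow 2 |>.const_mul (y ^ 2 / 2)
    simpa using this
  refine hsinc.congr' ?_
  filter_upwards [eventually_gt_atTop 0] with n hn
  have hn' : (0 : ℝ) < n := by exact_mod_cast hn
  have hs : √(n : ℝ) ^ 2 = n := Real.sq_sqrt hn'.le
  have hs0 : √(n : ℝ) ≠ 0 := (Real.sqrt_pos.2 hn').ne'
  set z := (√(n : ℝ))⁻¹ * y / 2 with hz
  have hz2 : (√(n : ℝ))⁻¹ * y = 2 * z := by rw [hz]; ring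
  have hsin : Real.sin z = z * Real.sinc z := by
    rcases eq_or_ne z 0 with h | h
    · simp [h]
    · rw [Real.sinc_of_ne_zero h]
      field_simp
  have hy : (n : ℝ) * z ^ 2 = y ^ 2 / 4 := by
    rw [hz, ← hs]
    field_simp
    norm_num
  rw [hz2, Real.cos_two_mul, Real.cos_sq', hsin]
  linear_combination (-2 * Real.sinc z ^ 2) * hy

theorem tendsto_normSq_trigSum_div_pow {ι : Type*} [Fintype ι] [Nonempty ι] (x : ι → ℝ) :
    Tendsto (fun n : ℕ => (Complex.normSq (trigSum ((√(n : ℝ))⁻¹ • x)) /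
        (Fintype.card ι : ℝ) ^ 2) ^ n) atTop
      (𝓝 (Real.exp (-((∑ j, ∑ k, (x j - x k) ^ 2 / 2) / (Fintype.card ι : ℝ) ^ 2)))) := by
  have hd : (Fintype.card ι : ℝ) ≠ 0 := by exact_mod_cast Fintype.card_ne_zero
  have hlim := ((tendsto_finsetSum univ fun j _ => tendsto_finsetSum univ fun k _ =>
    tendsto_mul_one_sub_cos_div_sqrt (x j - x k)).div_const ((Fintype.card ι : ℝ) ^ 2)).neg
  refine (Real.tendsto_one_add_pow_exp_of_tendsto (g := fun n : ℕ =>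
    -((∑ j, ∑ k, (1 - Real.cos ((√(n : ℝ))⁻¹ * (x j - x k)))) / (Fintype.card ι : ℝ) ^ 2))
    (hlim.congr fun n => ?_)).congr fun n => ?_
  · simp only [← mul_sum]
    ring
  · congr 1
    rw [normSq_trigSum]
    simp only [Pi.smul_apply, smul_eq_mul, ← mul_sub, sum_sub_distrib, sum_const, card_univ,
      nsmul_eq_mul, mul_one]
    field_simp
    ring

/-- The total mass of a Gaussian whose quadratic form is the variance of `(0, t)`. -/
theorem integral_exp_neg_variance (m : ℕ) :
    ∫ t : Fin m → ℝ, Real.exp (-((∑ j, t j ^ 2) / (m + 1) - (∑ j, t j) ^ 2 / ((m : ℝ) + 1) ^ 2)) =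
      √(Real.pi * (m + 1)) ^ m * √((m : ℝ) + 1) := by
  set d : ℝ := (m : ℝ) + 1 with hd
  have hd0 : 0 < d := by positivity
  let f : (Fin m → ℝ) → ℝ → ℝ := fun t y =>
    Real.exp (-d⁻¹ * y ^ 2) * ∏ j, Real.exp (-d⁻¹ * (t j - y) ^ 2)
  have hf : ∀ t y, f t y =
      Real.exp (-((∑ j, t j ^ 2) / d - (∑ j, t j) ^ 2 / d ^ 2)) *
        Real.exp (-1 * (y - (∑ j, t j) / d) ^ 2) := by
    intro t y
    simp only [f, ← Real.exp_sum, ← Real.exp_add]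
    congr 1
    simp only [sub_sq, mul_add, mul_sub, sum_add_distrib, sum_sub_distrib, ← mul_sum, ← sum_mul,
      sum_const, card_univ, Fintype.card_fin, nsmul_eq_mul]
    have hm : (m : ℝ) = d - 1 := by rw [hd]; ring
    rw [hm]
    field_simp
    ring
  have hgauss : ∀ b c : ℝ, ∫ y : ℝ, Real.exp (-b * (y - c) ^ 2) = √(Real.pi / b) := fun b c => by
    rw [integral_sub_right_eq_self (fun y => Real.exp (-b * y ^ 2)) c, integral_gaussian]
  have hint : ∀ y, ∫ t, f t y = Real.exp (-d⁻¹ * y ^ 2) * √(Real.pi * d) ^ m := by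
    intro y
    simp only [f]
    rw [integral_const_mul,
      integral_fintype_prod_volume_eq_prod (fun _ (s : ℝ) => Real.exp (-d⁻¹ * (s - y) ^ 2))]
    simp only [hgauss, prod_const, card_univ, Fintype.card_fin, div_inv_eq_mul]
  have hpos : ∀ t y, 0 ≤ f t y := fun t y => by simp only [f]; positivity
  have hcont : Continuous (Function.uncurry f) := by
    simp only [f, Function.uncurry_def]
    fun_prop
  have hgi : Integrable fun y : ℝ => Real.exp (-d⁻¹ * y ^ 2) :=
    integrable_exp_neg_mul_sq (inv_pos.2 hd0)
  have hfi : Integrable (Function.uncurry f) (volume.prod volume) := by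
    rw [integrable_prod_iff' hcont.aestronglyMeasurable]
    constructor
    · refine ae_of_all _ fun y => ?_
      simp only [Function.uncurry, f]
      exact (Integrable.fintype_prod fun _ : Fin m => hgi.comp_sub_right y).const_mul _
    · simp only [Function.uncurry, Real.norm_of_nonneg (hpos _ _), hint]
      exact hgi.mul_const _
  have hswap := integral_integral_swap hfi
  simp only [hint] at hswap
  simp only [hf, integral_const_mul, integral_mul_const, hgauss, integral_gaussian] at hswap
  have hpi : √Real.pi ≠ 0 := (Real.sqrt_pos.2 Real.pi_pos).ne'
  rw [div_one, div_inv_eq_mul, Real.sqrt_mul Real.pi_pos.le d] at hswap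
  rw [← mul_left_inj' hpi, hswap, Real.sqrt_mul Real.pi_pos.le d]
  ring

theorem sum_sum_sub_sq_cons_zero {m : ℕ} (t : Fin m → ℝ) :
    (∑ j, ∑ k, ((Fin.cons 0 t : Fin (m + 1) → ℝ) j - (Fin.cons 0 t : Fin (m + 1) → ℝ) k) ^ 2 / 2) /
        ((m : ℝ) + 1) ^ 2 =
      (∑ j, t j ^ 2) / (m + 1) - (∑ j, t j) ^ 2 / ((m : ℝ) + 1) ^ 2 := by
  have h : ∑ j, ∑ k, (t j - t k) ^ 2 / 2 = m * ∑ j, t j ^ 2 - (∑ j, t j) ^ 2 := by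
    simp only [sub_sq, sub_div, add_div, sum_add_distrib, sum_sub_distrib, sum_const, card_univ,
      Fintype.card_fin, nsmul_eq_mul, ← sum_div, ← mul_sum, ← sum_mul]
    ring
  simp only [Fin.sum_univ_succ, Fin.cons_zero, Fin.cons_succ, sum_add_distrib, h]
  have hm : (m : ℝ) + 1 ≠ 0 := by positivity
  simp only [sub_zero, zero_sub, neg_sq, ← sum_div]
  field_simp
  ring

theorem norm_wordKernel {m : ℕ} (n : ℕ) (ξ : Fin (m + 1) → ℤ) (x : Fin (m + 1) → ℝ) :
    ‖wordKernel n ξ x‖ =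
      ‖trigSum x‖ ^ (2 * n + (∑ j, (ξ j).toNat + ∑ j, (-ξ j).toNat)) := by
  have h : ∀ j, ‖Complex.exp (-(ξ j * x j * Complex.I))‖ = 1 := fun j => by
    have := Complex.norm_exp_ofReal_mul_I (-(ξ j * x j))
    push_cast at this
    rwa [neg_mul] at this
  simp only [wordKernel, norm_mul, norm_pow, RCLike.norm_conj, norm_prod, h, prod_const_one,
    mul_one, ← pow_add]
  congr 1
  ring

theorem norm_wordKernel_div_le {m : ℕ} (n : ℕ) (ξ : Fin (m + 1) → ℤ) {θ : Fin m → ℝ}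
    (hθ : θ ∈ piCube m) :
    ‖wordKernel n ξ (Fin.cons 0 θ) /
        ((m : ℂ) + 1) ^ (2 * n + (∑ j, (ξ j).toNat + ∑ j, (-ξ j).toNat))‖ ≤
      Real.exp (-(4 / (Real.pi * (m + 1)) ^ 2) * (n * ∑ j, θ j ^ 2)) := by
  have hd : (0 : ℝ) < (m : ℝ) + 1 := by positivity
  have hnd : ‖(m : ℂ) + 1‖ = (m : ℝ) + 1 := by
    rw [← Nat.cast_add_one, Complex.norm_natCast]
    push_cast
    rfl
  set T := trigSum (Fin.cons 0 θ : Fin (m + 1) → ℝ)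
  have hT : ‖T‖ / (m + 1) ≤ 1 := by
    rw [div_le_one hd]
    simpa using norm_trigSum_le (Fin.cons 0 θ : Fin (m + 1) → ℝ)
  have hsq : (‖T‖ / (m + 1)) ^ 2 ≤
      Real.exp (-(4 / (Real.pi * (m + 1)) ^ 2) * ∑ j, θ j ^ 2) := by
    have h1 := normSq_trigSum_cons_zero_le hθ
    rw [Complex.normSq_eq_norm_sq] at h1
    refine le_trans ?_ (Real.add_one_le_exp _)
    rw [div_pow, div_le_iff₀ (by positivity)]
    refine h1.trans (le_of_eq ?_)
    have := Real.pi_pos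
    field_simp
    ring
  rw [norm_div, norm_pow, norm_wordKernel, hnd, ← div_pow, pow_add, pow_mul]
  calc ((‖T‖ / (m + 1)) ^ 2) ^ n * (‖T‖ / (m + 1)) ^ _
      ≤ ((‖T‖ / (m + 1)) ^ 2) ^ n :=
        mul_le_of_le_one_right (by positivity) (pow_le_one₀ (by positivity) hT)
    _ ≤ Real.exp (-(4 / (Real.pi * (m + 1)) ^ 2) * ∑ j, θ j ^ 2) ^ n := by gcongr
    _ = _ := by
        rw [← Real.exp_nat_mul]
        congr 1
        ring

theorem tendsto_wordKernel_div {m : ℕ} (ξ : Fin (m + 1) → ℤ) (x : Fin (m + 1) → ℝ) :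
    Tendsto (fun n : ℕ => wordKernel n ξ ((√(n : ℝ))⁻¹ • x) /
        ((m : ℂ) + 1) ^ (2 * n + (∑ j, (ξ j).toNat + ∑ j, (-ξ j).toNat))) atTop
      (𝓝 (Real.exp (-((∑ j, ∑ k, (x j - x k) ^ 2 / 2) / ((m : ℝ) + 1) ^ 2)) : ℝ)) := by
  have hd : (m : ℂ) + 1 ≠ 0 := by exact_mod_cast (Nat.succ_ne_zero m)
  have harg : Tendsto (fun n : ℕ => (√(n : ℝ))⁻¹ • x) atTop (𝓝 0) := by
    simpa using tendsto_inv_sqrt_natCast.smul_const x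
  let r : (Fin (m + 1) → ℝ) → ℂ := fun y =>
    wordKernel 0 ξ y / ((m : ℂ) + 1) ^ (∑ j, (ξ j).toNat + ∑ j, (-ξ j).toNat)
  have hr : Tendsto (fun n : ℕ => r ((√(n : ℝ))⁻¹ • x)) atTop (𝓝 1) := by
    have hc : Continuous r := (continuous_wordKernel 0 ξ).div_const _
    have h0 : r 0 = 1 := by
      simp [r, wordKernel, trigSum, ← pow_add, hd]
    have := (hc.tendsto 0).comp harg
    rwa [h0] at this
  have hmain := tendsto_normSq_trigSum_div_pow x
  simp only [Fintype.card_fin, Nat.cast_add_one] at hmain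
  have := ((Complex.continuous_ofReal.tendsto _).comp hmain).mul hr
  rw [mul_one] at this
  refine this.congr fun n => ?_
  simp only [Function.comp, r, wordKernel, zero_add]
  push_cast
  rw [← Complex.mul_conj]
  rw [div_pow, div_mul_div_comm, mul_pow]
  congr 1
  · ring
  · rw [← pow_mul, ← pow_add]

theorem tendsto_integral_wordKernel {m : ℕ} (ξ : Fin (m + 1) → ℤ) :
    Tendsto (fun n : ℕ => ∫ t : Fin m → ℝ, (piCube m).indicator
        (fun θ => wordKernel n ξ (Fin.cons 0 θ) /
          ((m : ℂ) + 1) ^ (2 * n + (∑ j, (ξ j).toNat + ∑ j, (-ξ j).toNat)))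
        ((√(n : ℝ))⁻¹ • t)) atTop
      (𝓝 ((√(Real.pi * (m + 1)) ^ m * √((m : ℝ) + 1) : ℝ) : ℂ)) := by
  rw [← integral_exp_neg_variance, ← integral_complex_ofReal]
  have hcons : Continuous fun θ : Fin m → ℝ => (Fin.cons 0 θ : Fin (m + 1) → ℝ) :=
    continuous_const.finCons continuous_id
  have hc : 0 < 4 / (Real.pi * (m + 1)) ^ 2 := by have := Real.pi_pos; positivity
  refine tendsto_integral_filter_of_dominated_convergence
    (fun t : Fin m → ℝ => ∏ j, Real.exp (-(4 / (Real.pi * (m + 1)) ^ 2) * t j ^ 2)) ?_ ?_ ?_ ?_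
  · refine Eventually.of_forall fun n => ?_
    have hm : Measurable ((piCube m).indicator (fun θ => wordKernel n ξ (Fin.cons 0 θ) /
          ((m : ℂ) + 1) ^ (2 * n + (∑ j, (ξ j).toNat + ∑ j, (-ξ j).toNat)))) :=
      (((continuous_wordKernel n ξ).comp hcons).div_const _).measurable.indicator
        (measurableSet_piCube m)
    exact (hm.comp (measurable_const_smul _)).aestronglyMeasurable
  · filter_upwards [eventually_gt_atTop 0] with n hn
    refine ae_of_all _ fun t => ?_
    have hn' : (0 : ℝ) < n := by exact_mod_cast hn
    by_cases ht : (√(n : ℝ))⁻¹ • t ∈ piCube m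
    · rw [Set.indicator_of_mem ht]
      refine (norm_wordKernel_div_le n ξ ht).trans (le_of_eq ?_)
      rw [← Real.exp_sum, ← mul_sum]
      congr 2
      simp only [Pi.smul_apply, smul_eq_mul, mul_pow, inv_pow, Real.sq_sqrt hn'.le, ← mul_sum]
      field_simp
    · rw [Set.indicator_of_notMem ht, norm_zero]
      positivity
  · exact Integrable.fintype_prod fun _ : Fin m => integrable_exp_neg_mul_sq hc
  · refine ae_of_all _ fun t => ?_
    have hlim := tendsto_wordKernel_div ξ (Fin.cons 0 t)
    rw [sum_sum_sub_sq_cons_zero] at hlim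
    refine hlim.congr' ?_
    have harg : Tendsto (fun n : ℕ => (√(n : ℝ))⁻¹ • t) atTop (𝓝 0) := by
      simpa using tendsto_inv_sqrt_natCast.smul_const t
    have hnhds : piCube m ∈ 𝓝 (0 : Fin m → ℝ) :=
      set_pi_mem_nhds Set.finite_univ fun _ _ =>
        Ioc_mem_nhds (by simpa using Real.pi_pos) Real.pi_pos
    filter_upwards [harg.eventually_mem hnhds] with n hn
    rw [Set.indicator_of_mem hn]
    congr 2
    ext j
    refine Fin.cases ?_ (fun j => ?_) j <;> simp

theorem integral_indicator_wordKernel {m : ℕ} (n : ℕ) (ξ : Fin (m + 1) → ℤ) :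
    ∫ t : Fin m → ℝ, (piCube m).indicator
        (fun θ => wordKernel n ξ (Fin.cons 0 θ) /
          ((m : ℂ) + 1) ^ (2 * n + (∑ j, (ξ j).toNat + ∑ j, (-ξ j).toNat)))
        ((√(n : ℝ))⁻¹ • t) =
      ((√(n : ℝ) ^ m * (2 * Real.pi) ^ m * wcount (m + 1) n ξ /
        ((m : ℝ) + 1) ^ (2 * n + (∑ j, (ξ j).toNat + ∑ j, (-ξ j).toNat)) : ℝ) : ℂ) := by
  rw [Measure.integral_comp_inv_smul, integral_indicator (measurableSet_piCube m), integral_div,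
    setIntegral_piCube_wordKernel, Module.finrank_fin_fun, abs_of_nonneg (by positivity),
    Complex.real_smul]
  push_cast
  ring

theorem tendsto_scaled_wcount {m : ℕ} (ξ : Fin (m + 1) → ℤ) :
    Tendsto (fun n : ℕ => √(n : ℝ) ^ m * (2 * Real.pi) ^ m * wcount (m + 1) n ξ /
        ((m : ℝ) + 1) ^ (2 * n + (∑ j, (ξ j).toNat + ∑ j, (-ξ j).toNat))) atTop
      (𝓝 (√(Real.pi * (m + 1)) ^ m * √((m : ℝ) + 1))) := by
  have h := (Complex.continuous_re.tendsto _).comp (tendsto_integral_wordKernel ξ)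
  simp only [integral_indicator_wordKernel] at h
  exact h

theorem wcount_asymptotic
    (d : ℕ) (hd : 1 ≤ d) (ξ : Fin d → ℤ) :
    Filter.Tendsto
      (fun n : ℕ =>
        (wcount d n ξ : ℝ) /
          ((d : ℝ) ^ (2 * (n : ℝ) + (d : ℝ) / 2 + ∑ j, ((ξ j).natAbs : ℝ)) *
            (4 * Real.pi * (n : ℝ)) ^ ((1 - (d : ℝ)) / 2)))
      Filter.atTop (nhds 1) := by
  obtain ⟨m, rfl⟩ : ∃ m, d = m + 1 := ⟨d - 1, by omega⟩
  have hd0 : (0 : ℝ) < (m : ℝ) + 1 := by positivity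
  have hpi := Real.pi_pos
  have hL : √(Real.pi * (m + 1)) ^ m * √((m : ℝ) + 1) ≠ 0 := by positivity
  have hlim := (tendsto_scaled_wcount ξ).div_const (√(Real.pi * (m + 1)) ^ m * √((m : ℝ) + 1))
  rw [div_self hL] at hlim
  refine hlim.congr' ?_
  filter_upwards [eventually_gt_atTop 0] with n hn
  have hn' : (0 : ℝ) < n := by exact_mod_cast hn
  have habs : ∑ j, ((ξ j).natAbs : ℝ) =
      ((∑ j, (ξ j).toNat + ∑ j, (-ξ j).toNat : ℕ) : ℝ) := by
    rw [← sum_add_distrib, ← Nat.cast_sum]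
    congr 1
    exact sum_congr rfl fun j _ => by omega
  have hpow : ((m + 1 : ℕ) : ℝ) ^
        (2 * (n : ℝ) + ((m + 1 : ℕ) : ℝ) / 2 + ∑ j, ((ξ j).natAbs : ℝ)) =
      ((m : ℝ) + 1) ^ (2 * n + (∑ j, (ξ j).toNat + ∑ j, (-ξ j).toNat)) *
        √((m : ℝ) + 1) ^ (m + 1) := by
    rw [habs, Real.sqrt_eq_rpow, ← Real.rpow_mul_natCast hd0.le, ← Real.rpow_natCast,
      ← Real.rpow_add hd0]
    push_cast
    congr 1
    ring
  have hpow' : (4 * Real.pi * (n : ℝ)) ^ ((1 - ((m + 1 : ℕ) : ℝ)) / 2) =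
      ((2 * √Real.pi * √(n : ℝ)) ^ m)⁻¹ := by
    have hs : 2 * √Real.pi * √(n : ℝ) = √(4 * Real.pi * n) := by
      rw [Real.sqrt_mul (by positivity), Real.sqrt_mul (by norm_num),
        show (4 : ℝ) = 2 ^ 2 by norm_num, Real.sqrt_sq (by norm_num)]
    rw [hs, Real.sqrt_eq_rpow, ← Real.rpow_mul_natCast (by positivity),
      ← Real.rpow_neg (by positivity)]
    push_cast
    congr 1
    ring
  rw [hpow, hpow', Real.sqrt_mul hpi.le]
  have hsp : (2 * Real.pi) ^ m = (2 * √Real.pi) ^ m * √Real.pi ^ m := by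
    rw [← mul_pow, mul_assoc, Real.mul_self_sqrt hpi.le]
  rw [hsp]
  field_simp
  ring
end

section
/- Let d ≥ 1 and let x be a real number with 0 ≤ x < 1/d². Then Σ_{ξ ∈ ℤ^d} x^{‖ξ‖₁} · (Σ_{n=0}^∞ w_{(n,ξ)} x^n)² = (2π)^{−d} ∫_{[0,2π]^d} |1 − √x (e^{iθ₁}+⋯+e^{iθ_d})|^{−4} dθ, and in particular this sum over ξ ∈ ℤ^d is finite. -/
open MeasureTheory

/-- Grouping a summable family over `Fin d → ℕ` by total degree. -/
lemma hasSum_antidiagonalTuple {E : Type*} [NormedAddCommGroup E] {d : ℕ}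
    {f : (Fin d → ℕ) → E} {a : E} (hf : HasSum f a) :
    HasSum (fun n => ∑ ν ∈ Finset.Nat.antidiagonalTuple d n, f ν) a :=
  ((Finset.Nat.sigmaAntidiagonalTupleEquivTuple d).hasSum_iff.2 hf).sigma
    fun n => Finset.hasSum (Finset.Nat.antidiagonalTuple d n) f

lemma sum_pow_eq_sum_antidiagonalTuple {R : Type*} [CommSemiring R] {d : ℕ} (z : Fin d → R)
    (n : ℕ) :
    ∑ ν ∈ Finset.Nat.antidiagonalTuple d n,
      (Nat.multinomial Finset.univ ν : R) * ∏ j, z j ^ ν j = (∑ j, z j) ^ n := by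
  rw [Finset.sum_pow_eq_sum_piAntidiag, Finset.piAntidiag_univ_fin_eq_antidiagonalTuple]

lemma summable_multinomial_mul_prod_pow {d : ℕ} {r : Fin d → ℝ} (hr : ∀ j, 0 ≤ r j)
    (h : ∑ j, r j < 1) :
    Summable fun a : Fin d → ℕ => (Nat.multinomial Finset.univ a : ℝ) * ∏ j, r j ^ a j := by
  rw [← (Finset.Nat.sigmaAntidiagonalTupleEquivTuple d).summable_iff, summable_sigma_of_nonneg]
  · refine ⟨fun n => Summable.of_finite, ?_⟩
    convert summable_geometric_of_lt_one (Finset.sum_nonneg fun j _ => hr j) h with n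
    rw [← sum_pow_eq_sum_antidiagonalTuple]
    exact (Finset.hasSum (Finset.Nat.antidiagonalTuple d n)
      fun a => (Nat.multinomial Finset.univ a : ℝ) * ∏ j, r j ^ a j).tsum_eq
  · intro a
    exact mul_nonneg (Nat.cast_nonneg _) (Finset.prod_nonneg fun j _ => pow_nonneg (hr j) _)

lemma summable_norm_multinomial_mul_prod_pow {d : ℕ} {z : Fin d → ℂ} (h : ∑ j, ‖z j‖ < 1) :
    Summable fun a : Fin d → ℕ => ‖(Nat.multinomial Finset.univ a : ℂ) * ∏ j, z j ^ a j‖ := by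
  simpa using summable_multinomial_mul_prod_pow (fun j => norm_nonneg (z j)) h

/-- The multinomial expansion of `1 / (1 - (z₁ + ⋯ + z_d))`. -/
lemma hasSum_multinomial_mul_prod_pow {d : ℕ} {z : Fin d → ℂ} (h : ∑ j, ‖z j‖ < 1) :
    HasSum (fun a : Fin d → ℕ => (Nat.multinomial Finset.univ a : ℂ) * ∏ j, z j ^ a j)
      (1 - ∑ j, z j)⁻¹ := by
  have hs := (summable_norm_multinomial_mul_prod_pow h).of_norm.hasSum
  have hg := hasSum_antidiagonalTuple hs
  simp only [sum_pow_eq_sum_antidiagonalTuple] at hg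
  rw [← hg.unique (hasSum_geometric_of_norm_lt_one ((norm_sum_le _ _).trans_lt h))]
  exact hs

/-- The character of the torus with frequency `ξ`. -/
noncomputable def torusChar {d : ℕ} (ξ : Fin d → ℤ) (θ : Fin d → ℝ) : ℂ :=
  ∏ j, Complex.exp (Complex.I * (θ j : ℂ)) ^ ξ j

lemma norm_torusChar {d : ℕ} (ξ : Fin d → ℤ) (θ : Fin d → ℝ) : ‖torusChar ξ θ‖ = 1 := by
  simp [torusChar, Complex.norm_exp]

lemma torusChar_sub {d : ℕ} (ξ η : Fin d → ℤ) (θ : Fin d → ℝ) :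
    torusChar (ξ - η) θ = torusChar ξ θ * (starRingEnd ℂ) (torusChar η θ) := by
  rw [← Complex.inv_eq_conj (norm_torusChar η θ)]
  simp only [torusChar, ← Finset.prod_inv_distrib, ← Finset.prod_mul_distrib]
  refine Finset.prod_congr rfl fun j _ => ?_
  rw [Pi.sub_apply, zpow_sub₀ (Complex.exp_ne_zero _), div_eq_mul_inv]

lemma continuous_torusChar {d : ℕ} (ξ : Fin d → ℤ) : Continuous (torusChar ξ) := by
  refine continuous_finsetProd _ fun j _ => ?_
  exact Continuous.zpow₀ (by fun_prop) _ fun θ => Or.inl (Complex.exp_ne_zero _)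

lemma setIntegral_exp_zpow (n : ℤ) :
    ∫ t in Set.Icc (0 : ℝ) (2 * Real.pi), Complex.exp (Complex.I * (t : ℂ)) ^ n
      = if n = 0 then (2 * Real.pi : ℂ) else 0 := by
  rw [integral_Icc_eq_integral_Ioc, ← intervalIntegral.integral_of_le Real.two_pi_pos.le]
  split_ifs with h
  · simp [h]
  · have hc : (n : ℂ) * Complex.I ≠ 0 := by simp [h]
    have := integral_exp_mul_complex (a := 0) (b := 2 * Real.pi) hc
    simp_rw [← Complex.exp_int_mul, ← mul_assoc]
    rw [this]
    have h1 : Complex.exp ((n : ℂ) * Complex.I * ((2 * Real.pi : ℝ) : ℂ)) = 1 := by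
      rw [← Complex.exp_int_mul_two_pi_mul_I n]
      push_cast
      ring_nf
    rw [h1]
    simp

/-- Orthogonality of the characters on `[0, 2π]^d`. -/
lemma setIntegral_torusChar {d : ℕ} (ξ : Fin d → ℤ) :
    ∫ θ in Set.univ.pi fun _ : Fin d => Set.Icc (0 : ℝ) (2 * Real.pi), torusChar ξ θ
      = if ξ = 0 then ((2 * Real.pi) ^ d : ℂ) else 0 := by
  simp only [torusChar]
  rw [volume_pi, Measure.restrict_pi_pi,
    integral_fintype_prod_eq_prod
      (fun j (t : ℝ) => Complex.exp (Complex.I * (t : ℂ)) ^ ξ j)]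
  simp only [setIntegral_exp_zpow]
  split_ifs with h
  · simp [h]
  · obtain ⟨j, hj⟩ := Function.ne_iff.1 h
    exact Finset.prod_eq_zero (Finset.mem_univ j) (if_neg hj)

/-- Parseval's identity for absolutely convergent Fourier series on `[0, 2π]^d`. -/
lemma hasSum_sq_of_hasSum_torusChar {d : ℕ} {c : (Fin d → ℤ) → ℝ} (hc : Summable fun ξ => ‖c ξ‖)
    {F : (Fin d → ℝ) → ℝ} (hF : ∀ θ, HasSum (fun ξ => (c ξ : ℂ) * torusChar ξ θ) (F θ : ℂ)) :
    HasSum (fun ξ => c ξ ^ 2)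
      (1 / (2 * Real.pi) ^ d *
        ∫ θ in Set.univ.pi fun _ : Fin d => Set.Icc (0 : ℝ) (2 * Real.pi), F θ ^ 2) := by
  set B : Set (Fin d → ℝ) := Set.univ.pi fun _ : Fin d => Set.Icc (0 : ℝ) (2 * Real.pi) with hB
  have hBc : IsCompact B := isCompact_univ_pi fun _ => isCompact_Icc
  let G (p : (Fin d → ℤ) × (Fin d → ℤ)) (θ : Fin d → ℝ) : ℂ :=
    (c p.1 * c p.2 : ℂ) * torusChar (p.1 - p.2) θ
  have hcc : Summable fun p : (Fin d → ℤ) × (Fin d → ℤ) => ‖c p.1 * c p.2‖ := hc.mul_norm hc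
  have hnorm (p θ) : ‖G p θ‖ = ‖c p.1 * c p.2‖ := by simp [G, norm_torusChar]
  have hG (θ) : HasSum (fun p => G p θ) ((F θ ^ 2 : ℝ) : ℂ) := by
    have h1 := hF θ
    have h2 : HasSum (fun ξ => (c ξ : ℂ) * (starRingEnd ℂ) (torusChar ξ θ)) (F θ : ℂ) := by
      simpa using Complex.hasSum_conj'.2 h1
    have h3 := h1.mul h2 (summable_mul_of_summable_norm
      (f := fun ξ => (c ξ : ℂ) * torusChar ξ θ)
      (g := fun ξ => (c ξ : ℂ) * (starRingEnd ℂ) (torusChar ξ θ))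
      (by simpa [norm_torusChar] using hc) (by simpa [norm_torusChar] using hc))
    rw [Complex.ofReal_pow, sq]
    refine h3.congr_fun fun p => ?_
    simp only [G, torusChar_sub]
    ring
  have hint (p) : Integrable (G p) (volume.restrict B) :=
    ((continuous_const.mul (continuous_torusChar _)).continuousOn).integrableOn_compact hBc
  have hsum := hasSum_integral_of_summable_integral_norm hint (by
    simp only [hnorm, integral_const, smul_eq_mul]
    exact hcc.mul_left _)
  have hGi (p) : ∫ θ in B, G p θ
      = if p.2 = p.1 then ((2 * Real.pi) ^ d * c p.1 ^ 2 : ℂ) else 0 := by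
    simp only [G, integral_const_mul]
    rw [hB, setIntegral_torusChar]
    by_cases h : p.2 = p.1
    · simp [h]
      ring
    · simp [h, sub_eq_zero, Ne.symm h]
  simp only [hGi, (hG _).tsum_eq] at hsum
  have hdiag := hsum.prod_fiberwise
    (g := fun ξ => ((2 * Real.pi) ^ d * c ξ ^ 2 : ℂ)) fun ξ => by
      simpa using hasSum_ite_eq ξ ((2 * Real.pi) ^ d * c ξ ^ 2 : ℂ)
  rw [show ∫ θ in B, ((F θ ^ 2 : ℝ) : ℂ) = ((∫ θ in B, F θ ^ 2 : ℝ) : ℂ) from integral_ofReal]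
    at hdiag
  have hreal : HasSum (fun ξ => (2 * Real.pi) ^ d * c ξ ^ 2) (∫ θ in B, F θ ^ 2) := by
    exact_mod_cast hdiag
  have hpi : (2 * Real.pi) ^ d ≠ 0 := by positivity
  refine (hreal.mul_left (1 / (2 * Real.pi) ^ d)).congr_fun fun ξ => ?_
  field_simp

/-- Pairs `(a, b)` of multi-indices, described by the difference `a - b` and the minimum. -/
def offsetEquiv (d : ℕ) : (Fin d → ℤ) × (Fin d → ℕ) ≃ (Fin d → ℕ) × (Fin d → ℕ) where
  toFun p := (fun j => p.2 j + (p.1 j).toNat, fun j => p.2 j + (-p.1 j).toNat)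
  invFun q := (fun j => (q.1 j : ℤ) - q.2 j, fun j => min (q.1 j) (q.2 j))
  left_inv p := by
    ext j
    · simp only
      omega
    · simp only
      omega
  right_inv q := by
    ext j
    · simp only
      omega
    · simp only
      omega

/-- The weight of a pair of words with letter counts `a` and `b`. -/
noncomputable def pairWeight {d : ℕ} (s : ℝ) (q : (Fin d → ℕ) × (Fin d → ℕ)) : ℝ :=
  (Nat.multinomial Finset.univ q.1 * ∏ j, s ^ q.1 j) *
    (Nat.multinomial Finset.univ q.2 * ∏ j, s ^ q.2 j)

lemma summable_norm_pairWeight {d : ℕ} {s : ℝ} (hs : 0 ≤ s) (h : d * s < 1) :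
    Summable fun q : (Fin d → ℕ) × (Fin d → ℕ) => ‖pairWeight s q‖ := by
  have h1 := (summable_multinomial_mul_prod_pow (d := d) (r := fun _ => s) (fun _ => hs)
    (by simpa using h)).norm
  simp only [pairWeight]
  exact Summable.mul_norm
    (f := fun a : Fin d → ℕ => (Nat.multinomial Finset.univ a : ℝ) * ∏ j, s ^ a j)
    (g := fun a : Fin d → ℕ => (Nat.multinomial Finset.univ a : ℝ) * ∏ j, s ^ a j) h1 h1

lemma hasSum_pairWeight_mul_torusChar {d : ℕ} {s : ℝ} (hs : 0 ≤ s) (h : d * s < 1)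
    (θ : Fin d → ℝ) :
    HasSum (fun p : (Fin d → ℤ) × (Fin d → ℕ) =>
        (pairWeight s (offsetEquiv d p) : ℂ) * torusChar p.1 θ)
      ((1 / Complex.normSq (1 - (s : ℂ) * ∑ j, Complex.exp (Complex.I * (θ j : ℂ))) : ℝ) : ℂ) := by
  have hz : ∑ j, ‖(s : ℂ) * Complex.exp (Complex.I * (θ j : ℂ))‖ < 1 := by
    simpa [Complex.norm_exp, abs_of_nonneg hs] using h
  set m : (Fin d → ℕ) → ℂ := fun a => (Nat.multinomial Finset.univ a : ℂ) *
    ∏ j, ((s : ℂ) * Complex.exp (Complex.I * (θ j : ℂ))) ^ a j with hm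
  have h1 : HasSum m (1 - (s : ℂ) * ∑ j, Complex.exp (Complex.I * (θ j : ℂ)))⁻¹ := by
    rw [Finset.mul_sum]
    exact hasSum_multinomial_mul_prod_pow hz
  have hn : Summable fun a => ‖m a‖ := summable_norm_multinomial_mul_prod_pow hz
  have hn' : Summable fun a => ‖(starRingEnd ℂ) (m a)‖ := by simpa only [RCLike.norm_conj] using hn
  have h3 := h1.mul (Complex.hasSum_conj'.2 h1)
    (summable_mul_of_summable_norm (f := m) (g := fun a => (starRingEnd ℂ) (m a)) hn hn')
  rw [map_inv₀ (starRingEnd ℂ), ← mul_inv, Complex.mul_conj, ← Complex.ofReal_inv, ← one_div,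
    ← (offsetEquiv d).hasSum_iff] at h3
  refine h3.congr_fun fun p => ?_
  have hchar : torusChar p.1 θ = (∏ j, Complex.exp (Complex.I * (θ j : ℂ)) ^
        (offsetEquiv d p).1 j) *
      (starRingEnd ℂ) (∏ j, Complex.exp (Complex.I * (θ j : ℂ)) ^ (offsetEquiv d p).2 j) := by
    have := torusChar_sub (fun j => ((offsetEquiv d p).1 j : ℤ))
      (fun j => ((offsetEquiv d p).2 j : ℤ)) θ
    simp only [torusChar, zpow_natCast] at this
    rw [← this]
    refine Finset.prod_congr rfl fun j _ => ?_
    congr 1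
    exact (congrFun (congrArg Prod.fst ((offsetEquiv d).symm_apply_apply p)) j).symm
  rw [hchar]
  simp only [hm, pairWeight, Function.comp_apply, mul_pow, Finset.prod_mul_distrib, map_mul,
    map_prod, map_pow, Complex.conj_ofReal, map_natCast]
  push_cast
  ring

lemma hasSum_pairWeight_fiber {d : ℕ} {s : ℝ} (hs : 0 ≤ s) (h : d * s < 1) (ξ : Fin d → ℤ) :
    HasSum (fun ν : Fin d → ℕ => pairWeight s (offsetEquiv d (ξ, ν)))
      (s ^ (∑ j, (ξ j).natAbs) * ∑' n : ℕ, (wcount d n ξ : ℝ) * (s ^ 2) ^ n) := by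
  have hsum : Summable fun ν : Fin d → ℕ => pairWeight s (offsetEquiv d (ξ, ν)) :=
    ((offsetEquiv d).summable_iff.2 (summable_norm_pairWeight hs h).of_norm).prod_factor ξ
  have hg := hasSum_antidiagonalTuple hsum.hasSum
  have hterm (n : ℕ) : ∑ ν ∈ Finset.Nat.antidiagonalTuple d n, pairWeight s (offsetEquiv d (ξ, ν))
      = s ^ (∑ j, (ξ j).natAbs) * ((wcount d n ξ : ℝ) * (s ^ 2) ^ n) := by
    simp only [wcount, Nat.cast_sum, Finset.sum_mul, Finset.mul_sum]
    refine Finset.sum_congr rfl fun ν hν => ?_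
    have hdeg : (∑ j, (ν j + (ξ j).toNat)) + ∑ j, (ν j + (-ξ j).toNat)
        = (∑ j, (ξ j).natAbs) + 2 * n := by
      rw [← Finset.Nat.mem_antidiagonalTuple.1 hν, Finset.mul_sum, ← Finset.sum_add_distrib,
        ← Finset.sum_add_distrib]
      exact Finset.sum_congr rfl fun j _ => by omega
    have hpow : (s ^ ∑ j, (ν j + (ξ j).toNat)) * s ^ ∑ j, (ν j + (-ξ j).toNat)
        = s ^ (∑ j, (ξ j).natAbs) * (s ^ 2) ^ n := by
      rw [← pow_add, hdeg, pow_add, pow_mul]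
    simp only [pairWeight, offsetEquiv, Equiv.coe_fn_mk, Finset.prod_pow_eq_pow_sum]
    push_cast
    linear_combination (Nat.multinomial Finset.univ (fun j => ν j + (ξ j).toNat) : ℝ) *
      (Nat.multinomial Finset.univ (fun j => ν j + (-ξ j).toNat) : ℝ) * hpow
  simp only [hterm] at hg
  rw [← tsum_mul_left, hg.tsum_eq]
  exact hsum.hasSum

theorem parseval_offset_words
    (d : ℕ) (hd : 1 ≤ d) (x : ℝ) (hx0 : 0 ≤ x) (hx : x < 1 / (d : ℝ) ^ 2) :
    (Summable fun ξ : Fin d → ℤ =>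
        x ^ (∑ j, (ξ j).natAbs) * (∑' n : ℕ, (wcount d n ξ : ℝ) * x ^ n) ^ 2) ∧
    (∑' ξ : Fin d → ℤ,
        x ^ (∑ j, (ξ j).natAbs) * (∑' n : ℕ, (wcount d n ξ : ℝ) * x ^ n) ^ 2)
      = (1 / (2 * Real.pi) ^ d) *
          ∫ θ in Set.univ.pi fun _ : Fin d => Set.Icc (0:ℝ) (2 * Real.pi),
            (1 / Complex.normSq
              (1 - (Real.sqrt x : ℂ) * ∑ j, Complex.exp (Complex.I * (θ j : ℂ)))) ^ 2 := by
  have hd0 : (0 : ℝ) < d := by exact_mod_cast hd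
  have hs := Real.sqrt_nonneg x
  have hsx : Real.sqrt x ^ 2 = x := Real.sq_sqrt hx0
  have hds : d * Real.sqrt x < 1 := by
    rw [lt_div_iff₀ (by positivity)] at hx
    refine lt_of_pow_lt_pow_left₀ 2 zero_le_one ?_
    rw [mul_pow, hsx]
    linarith
  have hfib := hasSum_pairWeight_fiber hs hds
  rw [hsx] at hfib
  have hc := ((offsetEquiv d).summable_iff.2 (summable_norm_pairWeight hs hds).of_norm).prod
  simp only [Function.comp_apply, (hfib _).tsum_eq] at hc
  have key := hasSum_sq_of_hasSum_torusChar hc.norm fun θ =>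
    (hasSum_pairWeight_mul_torusChar hs hds θ).prod_fiberwise fun ξ =>
      (Complex.hasSum_ofReal.2 (hfib ξ)).mul_right (torusChar ξ θ)
  simp only [mul_pow _ (tsum _), pow_right_comm _ _ 2, hsx] at key
  exact ⟨key.summable, key.tsum_eq⟩
end
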